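/- Assume A has an exponential function. Then the quotient group U₀(U_ℂ(𝔤), A) := U(U_ℂ(𝔤), A) / \widehat{U(Z(A))} is canonically isomorphic to the quotient of the first Chevalley–Eilenberg cohomology H¹_CE(𝔤, Z(A)_{anti-Hermitian}) by the image of U(Z(A))/exp(Z(A)_{anti-Hermitian}) under the map c ↦ [ξ ↦ c·(ξ ▷ c⁻¹)]. -/

import Mathlib

open TensorProduct

noncomputable section

/-- The data of a Hopf `*`-algebra structure (over `ℂ`) on a `*`-algebra `H`,
together with a chosen Sweedler representation `rep` of the comultiplication:
`Δ(g) = Σᵢ g₍₁₎ᵢ ⊗ g₍₂₎ᵢ` where the pairs `(g₍₁₎ᵢ, g₍₂₎ᵢ)` are listed by `rep g`. -/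
structure HopfStarData (H : Type) [Ring H] [Algebra ℂ H] [StarRing H] : Type where
  comul : H →ₗ[ℂ] H ⊗[ℂ] H
  counit : H →ₗ[ℂ] ℂ
  antipode : H →ₗ[ℂ] H
  rep : H → List (H × H)
  rep_spec : ∀ g, comul g = ((rep g).map fun p => p.1 ⊗ₜ[ℂ] p.2).sum
  comul_one : comul 1 = 1
  comul_mul : ∀ g h, comul (g * h) = comul g * comul h
  counit_one : counit 1 = 1
  counit_mul : ∀ g h, counit (g * h) = counit g * counit h
  coassoc : (TensorProduct.assoc ℂ H H H).toLinearMap ∘ₗ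
      (TensorProduct.map comul LinearMap.id) ∘ₗ comul
      = (TensorProduct.map LinearMap.id comul) ∘ₗ comul
  counit_comul_left : ∀ g, ((rep g).map fun p => counit p.1 • p.2).sum = g
  counit_comul_right : ∀ g, ((rep g).map fun p => counit p.2 • p.1).sum = g
  antipode_left : ∀ g, ((rep g).map fun p => antipode p.1 * p.2).sum = counit g • (1 : H)
  antipode_right : ∀ g, ((rep g).map fun p => p.1 * antipode p.2).sum = counit g • (1 : H)
  comul_star : ∀ g, comul (star g) = ((rep g).map fun p => star p.1 ⊗ₜ[ℂ] star p.2).sum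
  counit_star : ∀ g, counit (star g) = starRingEnd ℂ (counit g)
  antipode_star : ∀ g, antipode (star (antipode (star g))) = g

variable {H A : Type} [Ring H] [Algebra ℂ H] [StarRing H]

/-- `act` is a Hopf-algebraic `*`-action of `(H, D)` on the `*`-algebra `A`:
`g ▷ (xy) = (g₍₁₎ ▷ x)(g₍₂₎ ▷ y)`, `g ▷ 1 = ε(g)1` and `(g ▷ x)* = S(g)* ▷ x*`. -/
def IsStarAction [Ring A] [Algebra ℂ A] [StarRing A]
    (D : HopfStarData H) (act : H →ₗ[ℂ] A →ₗ[ℂ] A) : Prop :=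
  (∀ g h x, act (g * h) x = act g (act h x)) ∧
  (∀ x, act 1 x = x) ∧
  (∀ g x y, act g (x * y) = ((D.rep g).map fun p => act p.1 x * act p.2 y).sum) ∧
  (∀ g, act g 1 = D.counit g • 1) ∧
  (∀ g x, star (act g x) = act (star (D.antipode g)) (star x))

/-- The convolution product on `Hom(H, A)`: `(a * b)(g) = a(g₍₁₎) b(g₍₂₎)`. -/
def conv [Ring A] [Algebra ℂ A] (D : HopfStarData H) (a b : H →ₗ[ℂ] A) : H →ₗ[ℂ] A :=
  LinearMap.mul' ℂ A ∘ₗ TensorProduct.map a b ∘ₗ D.comul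

/-- The convolution unit `e(g) = ε(g) 1`. -/
def convUnit [Ring A] [Algebra ℂ A] (D : HopfStarData H) : H →ₗ[ℂ] A :=
  Algebra.linearMap ℂ A ∘ₗ D.counit

/-- Membership in `U(H, A)`: normalization, the cocycle condition, centrality and
unitarity, cf. (13)–(16) in the paper. -/
def IsUElem [Ring A] [Algebra ℂ A] [StarRing A]
    (D : HopfStarData H) (act : H →ₗ[ℂ] A →ₗ[ℂ] A) (a : H →ₗ[ℂ] A) : Prop :=
  a 1 = 1 ∧
  (∀ g h, a (g * h) = ((D.rep g).map fun p => a p.1 * act p.2 (a h)).sum) ∧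
  (∀ g b, ((D.rep g).map fun p => act p.1 b * a p.2).sum
        = ((D.rep g).map fun p => a p.1 * act p.2 b).sum) ∧
  (∀ g, ((D.rep g).map fun p => a p.1 * star (a (D.antipode (star p.2)))).sum
      = D.counit g • 1)

/-- `c` is a central element of `A`. -/
def IsCentral [Ring A] (c : A) : Prop := ∀ x, c * x = x * c

/-- `c` is a unitary central element of `A`. -/
def IsUnitaryCentral [Ring A] [StarRing A] (c : A) : Prop :=
  IsCentral c ∧ star c * c = 1 ∧ c * star c = 1

/-- For a unitary central element `c`, the map `ĉ(g) = c · (g ▷ c⁻¹) = c · (g ▷ c*)`. -/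
def chat [Ring A] [Algebra ℂ A] [StarRing A]
    (act : H →ₗ[ℂ] A →ₗ[ℂ] A) (c : A) : H →ₗ[ℂ] A :=
  LinearMap.mulLeft ℂ c ∘ₗ act.flip (star c)

variable {𝔤 : Type} [LieRing 𝔤] [LieAlgebra ℝ 𝔤]

namespace HopfStarData

/-- The Mathlib Hopf algebra underlying a `HopfStarData`. -/
abbrev toHopfAlgebra (D : HopfStarData H) : HopfAlgebra ℂ H where
  comul := D.comul
  counit := D.counit
  coassoc := D.coassoc
  rTensor_counit_comp_comul := by
    ext g
    have h := D.counit_comul_left g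
    simp only [LinearMap.comp_apply, D.rep_spec g, map_list_sum, List.map_map,
      TensorProduct.mk_apply]
    conv_rhs => rw [← h, ← TensorProduct.mk_apply, map_list_sum, List.map_map]
    congr 1
    refine List.map_congr_left fun p _ => ?_
    simp [TensorProduct.smul_tmul']
  lTensor_counit_comp_comul := by
    ext g
    have h := D.counit_comul_right g
    simp only [LinearMap.comp_apply, D.rep_spec g, map_list_sum, List.map_map,
      LinearMap.flip_apply, TensorProduct.mk_apply]
    conv_rhs => rw [← h, ← TensorProduct.mk_apply, ← LinearMap.flip_apply, map_list_sum,
      List.map_map]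
    congr 1
    refine List.map_congr_left fun p _ => ?_
    simp [← TensorProduct.tmul_smul]
  counit_one := D.counit_one
  mul_compr₂_counit := by ext; simp [D.counit_mul]
  comul_one := D.comul_one
  mul_compr₂_comul := by ext; simp [D.comul_mul]
  antipode := D.antipode
  mul_antipode_rTensor_comul := by
    ext g
    simpa [D.rep_spec g, map_list_sum, List.map_map, Function.comp_def,
      Algebra.algebraMap_eq_smul_one] using D.antipode_left g
  mul_antipode_lTensor_comul := by
    ext g
    simpa [D.rep_spec g, map_list_sum, List.map_map, Function.comp_def,
      Algebra.algebraMap_eq_smul_one] using D.antipode_right g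

theorem antipode_mul (D : HopfStarData H) (g h : H) :
    D.antipode (g * h) = D.antipode h * D.antipode g :=
  letI := D.toHopfAlgebra
  HopfAlgebra.antipode_mul_antidistrib (R := ℂ) g h

theorem antipode_one (D : HopfStarData H) : D.antipode 1 = 1 :=
  letI := D.toHopfAlgebra
  HopfAlgebra.antipode_one (R := ℂ) (A := H)

/-- Left contraction of the comultiplication with a functional: `g ↦ φ(g₍₁₎) g₍₂₎`. -/
def slice (D : HopfStarData H) (φ : H →ₗ[ℂ] ℂ) : H →ₗ[ℂ] H :=
  (TensorProduct.lid ℂ H).toLinearMap ∘ₗ φ.rTensor H ∘ₗ D.comul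

theorem slice_add (D : HopfStarData H) (φ ψ : H →ₗ[ℂ] ℂ) (g : H) :
    D.slice (φ + ψ) g = D.slice φ g + D.slice ψ g := by
  simp [slice, LinearMap.rTensor_add]

theorem slice_smul (D : HopfStarData H) (c : ℂ) (φ : H →ₗ[ℂ] ℂ) (g : H) :
    D.slice (c • φ) g = c • D.slice φ g := by
  simp [slice, LinearMap.rTensor_smul]

theorem slice_counit (D : HopfStarData H) (g : H) : D.slice D.counit g = g := by
  simpa [slice, D.rep_spec g, map_list_sum, List.map_map, Function.comp_def]
    using D.counit_comul_left g

theorem slice_one (D : HopfStarData H) (φ : H →ₗ[ℂ] ℂ) : D.slice φ 1 = φ 1 • (1 : H) := by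
  simp [slice, D.comul_one, Algebra.TensorProduct.one_def]

/-- `v` is a primitive element. -/
def IsPrim (D : HopfStarData H) (v : H) : Prop :=
  D.comul v = v ⊗ₜ[ℂ] 1 + 1 ⊗ₜ[ℂ] v

theorem slice_prim_mul (D : HopfStarData H) {v : H} (hv : D.IsPrim v) (φ : H →ₗ[ℂ] ℂ) (g : H) :
    D.slice φ (v * g) = D.slice (φ ∘ₗ LinearMap.mulLeft ℂ v) g + v * D.slice φ g := by
  have hv' : D.comul v = v ⊗ₜ[ℂ] 1 + 1 ⊗ₜ[ℂ] v := hv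
  simp only [slice, LinearMap.comp_apply, D.comul_mul, hv']
  induction D.comul g with
  | zero => simp
  | add x y hx hy => simp only [mul_add, map_add, hx, hy]; abel
  | tmul x y => simp [add_mul]

theorem slice_prim_mul' (D : HopfStarData H) {v : H} (hv : D.IsPrim v) (φ : H →ₗ[ℂ] ℂ) (g : H) :
    D.slice φ (v * g) = φ v • g
      + D.slice (φ ∘ₗ LinearMap.mulLeft ℂ v - φ v • D.counit) g + v * D.slice φ g := by
  rw [D.slice_prim_mul hv]
  congr 1
  conv_rhs => rw [← D.slice_counit g, ← slice_smul, D.slice_counit g, ← slice_add]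
  simp

end HopfStarData

theorem mem_of_adjoin_range_eq_top {B X : Type*} [Ring B] [Algebra ℂ B] {ι : X → B}
    (hgen : Algebra.adjoin ℂ (Set.range ι) = ⊤)
    (N : Submodule ℂ B) (h1 : 1 ∈ N) (hmul : ∀ ξ, ∀ h ∈ N, ι ξ * h ∈ N) (h : B) : h ∈ N := by
  have key : ∀ x ∈ Algebra.adjoin ℂ (Set.range ι), ∀ h ∈ N, x * h ∈ N := by
    intro x hx
    induction hx using Algebra.adjoin_induction with
    | mem x hx => obtain ⟨ξ, rfl⟩ := hx; exact hmul ξ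
    | algebraMap r =>
      intro h hh
      rw [← Algebra.smul_def]
      exact N.smul_mem _ hh
    | add x y _ _ hx hy =>
      intro h hh
      rw [add_mul]
      exact N.add_mem (hx h hh) (hy h hh)
    | mul x y _ _ hx hy =>
      intro h hh
      rw [mul_assoc]
      exact hx _ (hy h hh)
  simpa using key h (hgen ▸ Algebra.mem_top) 1 h1

/-- The span of the products of fewer than `n` members of the family `b`. -/
def wordSpan {B I : Type*} [Ring B] [Algebra ℂ B] (b : I → B) (n : ℕ) : Submodule ℂ B :=
  Submodule.span ℂ {x | ∃ l : List I, l.length < n ∧ (l.map b).prod = x}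

section wordSpan

variable {B I : Type*} [Ring B] [Algebra ℂ B] {b : I → B}

theorem word_mem_wordSpan {l : List I} {n : ℕ} (h : l.length < n) :
    (l.map b).prod ∈ wordSpan b n :=
  Submodule.subset_span ⟨l, h, rfl⟩

theorem wordSpan_le {n : ℕ} {N : Submodule ℂ B}
    (h : ∀ l : List I, l.length < n → (l.map b).prod ∈ N) : wordSpan b n ≤ N := by
  refine Submodule.span_le.2 ?_
  rintro _ ⟨l, hl, rfl⟩
  exact h l hl

theorem wordSpan_mono {m n : ℕ} (h : m ≤ n) : wordSpan b m ≤ wordSpan b n :=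
  wordSpan_le fun _ hl => word_mem_wordSpan (hl.trans_le h)

theorem wordSpan_zero : wordSpan b 0 = ⊥ :=
  le_bot_iff.1 (wordSpan_le fun _ hl => absurd hl (Nat.not_lt_zero _))

theorem exists_smul_one_of_mem_wordSpan_one {x : B} (h : x ∈ wordSpan b 1) :
    ∃ c : ℂ, x = c • 1 := by
  have : wordSpan b 1 ≤ Submodule.span ℂ {1} := wordSpan_le fun l hl => by
    obtain rfl : l = [] := List.length_eq_zero_iff.1 (by omega)
    simp [Submodule.mem_span_singleton_self]
  obtain ⟨c, hc⟩ := Submodule.mem_span_singleton.1 (this h)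
  exact ⟨c, hc.symm⟩

theorem mul_mem_wordSpan {i : I} {n : ℕ} {x : B} (h : x ∈ wordSpan b n) :
    b i * x ∈ wordSpan b (n + 1) := by
  have : wordSpan b n ≤ (wordSpan b (n + 1)).comap (LinearMap.mulLeft ℂ (b i)) :=
    wordSpan_le fun l hl => by
      simpa using word_mem_wordSpan (b := b) (l := i :: l) (n := n + 1) (by simpa using hl)
  exact this h

theorem word_mul_mem_wordSpan (l : List I) {n : ℕ} {x : B} (h : x ∈ wordSpan b n) :
    (l.map b).prod * x ∈ wordSpan b (n + l.length) := by
  induction l with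
  | nil => simpa using h
  | cons i l ih =>
    simpa [mul_assoc, ← add_assoc] using mul_mem_wordSpan ih

theorem span_mul_mem_wordSpan {v : B} (hv : v ∈ Submodule.span ℂ (Set.range b)) {n : ℕ} {x : B}
    (h : x ∈ wordSpan b n) : v * x ∈ wordSpan b (n + 1) := by
  induction hv using Submodule.span_induction with
  | mem v hv => obtain ⟨i, rfl⟩ := hv; exact mul_mem_wordSpan h
  | zero => simp
  | add v w _ _ hv hw => rw [add_mul]; exact add_mem hv hw
  | smul c v _ hv => rw [smul_mul_assoc]; exact Submodule.smul_mem _ _ hv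

theorem exists_mem_wordSpan (hgen : Algebra.adjoin ℂ (Set.range b) = ⊤) (x : B) :
    ∃ n, x ∈ wordSpan b n := by
  have hdir : Directed (· ≤ ·) (wordSpan b) := (monotone_nat_of_le_succ fun n =>
    wordSpan_mono n.le_succ).directed_le
  have := mem_of_adjoin_range_eq_top hgen (⨆ n, wordSpan b n)
    (Submodule.mem_iSup_of_mem 1 (by simpa using word_mem_wordSpan (b := b) (l := []) one_pos))
    (fun i h hh => by
      obtain ⟨n, hn⟩ := (Submodule.mem_iSup_of_directed _ hdir).1 hh
      exact Submodule.mem_iSup_of_mem (n + 1) (mul_mem_wordSpan hn)) x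
  exact (Submodule.mem_iSup_of_directed _ hdir).1 this

/-- Reordering a word changes it only by shorter words if the letters span a Lie algebra. -/
theorem word_sub_word_mem_wordSpan
    (hbr : ∀ i j, b i * b j - b j * b i ∈ Submodule.span ℂ (Set.range b)) {l l' : List I}
    (h : l.Perm l') : (l.map b).prod - (l'.map b).prod ∈ wordSpan b l.length := by
  induction h with
  | nil => simp
  | cons i _ ih => simpa [mul_sub] using mul_mem_wordSpan (i := i) ih
  | swap i j l =>
    have := span_mul_mem_wordSpan (hbr j i) (word_mem_wordSpan (b := b) (Nat.lt_succ_self l.length))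
    simpa [sub_mul, mul_assoc] using this
  | trans h₁ _ ih₁ ih₂ =>
    rw [← h₁.length_eq] at ih₂
    simpa using add_mem ih₁ ih₂

end wordSpan

namespace HopfStarData

section slice

variable {I : Type*} {b : I → H} {D : HopfStarData H}

theorem slice_mem_wordSpan (hb : ∀ i, D.IsPrim (b i)) {φ : H →ₗ[ℂ] ℂ} (hφ : φ 1 = 0) {n : ℕ}
    {x : H} (hx : x ∈ wordSpan b (n + 1)) : D.slice φ x ∈ wordSpan b n := by
  have key : ∀ (l : List I) (φ : H →ₗ[ℂ] ℂ), φ 1 = 0 →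
      D.slice φ (l.map b).prod ∈ wordSpan b l.length := by
    intro l
    induction l with
    | nil => intro φ hφ; simp [D.slice_one, hφ]
    | cons i l ih =>
      intro φ hφ
      simp only [List.map_cons, List.prod_cons, List.length_cons, D.slice_prim_mul' (hb i)]
      refine add_mem (add_mem (Submodule.smul_mem _ _ (word_mem_wordSpan (Nat.lt_succ_self _))) ?_)
        (mul_mem_wordSpan (ih φ hφ))
      exact wordSpan_mono (Nat.le_succ _) (ih _ (by simp [D.counit_one]))
  have : wordSpan b (n + 1) ≤ (wordSpan b n).comap (D.slice φ) := wordSpan_le fun l hl =>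
    wordSpan_mono (Nat.lt_succ_iff.1 hl) (key l φ hφ)
  exact this hx

theorem slice_pow_eq_zero (hb : ∀ i, D.IsPrim (b i)) {φ : H →ₗ[ℂ] ℂ} (hφ : φ 1 = 0) {n : ℕ}
    {x : H} (hx : x ∈ wordSpan b n) : (D.slice φ ^ n) x = 0 := by
  induction n generalizing x with
  | zero => simpa [wordSpan_zero] using hx
  | succ n ih => rw [pow_succ]; exact ih (slice_mem_wordSpan hb hφ hx)

theorem slice_pow_mem (hb : ∀ i, D.IsPrim (b i)) {φ : H →ₗ[ℂ] ℂ} (hφ : φ 1 = 0) {n m : ℕ}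
    {x : H} (hx : x ∈ wordSpan b (m + n)) : (D.slice φ ^ n) x ∈ wordSpan b m := by
  induction n generalizing x with
  | zero => simpa using hx
  | succ n ih => rw [pow_succ]; exact ih (slice_mem_wordSpan hb hφ hx)

theorem slice_pow_mul (hb : ∀ i, D.IsPrim (b i)) {φ : H →ₗ[ℂ] ℂ} (hφ : φ 1 = 0) (i : I) {n : ℕ}
    {x : H} (hx : x ∈ wordSpan b (n + 1)) :
    (D.slice φ ^ (n + 1)) (b i * x) = ((n + 1 : ℂ) * φ (b i)) • (D.slice φ ^ n) x := by
  induction n generalizing x with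
  | zero =>
    have h0 : ∀ ψ : H →ₗ[ℂ] ℂ, ψ 1 = 0 → D.slice ψ x = 0 := fun ψ hψ => by
      simpa [wordSpan_zero] using slice_mem_wordSpan hb hψ hx
    simp only [zero_add, pow_one, D.slice_prim_mul' (hb i), h0 φ hφ, pow_zero]
    rw [h0 _ (by simp [D.counit_one])]
    simp
  | succ n ih =>
    rw [pow_succ, Module.End.mul_apply, D.slice_prim_mul' (hb i), map_add, map_add,
      slice_pow_eq_zero hb hφ (slice_mem_wordSpan hb (by simp [D.counit_one]) hx),
      ih (slice_mem_wordSpan hb hφ hx), map_smul, add_zero, pow_succ (D.slice φ) n,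
      Module.End.mul_apply, ← add_smul]
    congr 1
    push_cast
    ring

theorem slice_pow_word_mul (hb : ∀ i, D.IsPrim (b i)) {φ : H →ₗ[ℂ] ℂ} (hφ : φ 1 = 0)
    (l : List I) {m : ℕ} {x : H} (hx : x ∈ wordSpan b (m + 1)) :
    (m.factorial : ℂ) • (D.slice φ ^ (m + l.length)) ((l.map b).prod * x)
      = ((m + l.length).factorial * (l.map fun i => φ (b i)).prod : ℂ) • (D.slice φ ^ m) x := by
  induction l with
  | nil => simp
  | cons i l ih =>
    have h := slice_pow_mul hb hφ i (n := m + l.length)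
      (x := (l.map b).prod * x) (by convert word_mul_mem_wordSpan l hx using 2; ring)
    simp only [List.map_cons, List.prod_cons, List.length_cons, mul_assoc, ← add_assoc, h]
    rw [smul_comm, ih, smul_smul, Nat.factorial_succ]
    congr 1
    push_cast
    ring

theorem slice_pow_word (hb : ∀ i, D.IsPrim (b i)) {φ : H →ₗ[ℂ] ℂ} (hφ : φ 1 = 0) (l : List I) :
    (D.slice φ ^ l.length) (l.map b).prod
      = (l.length.factorial * (l.map fun i => φ (b i)).prod : ℂ) • (1 : H) := by
  simpa using slice_pow_word_mul hb hφ l (m := 0) (x := 1)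
    (by simpa using word_mem_wordSpan (b := b) (l := []) one_pos)

theorem slice_pow_mul_of_mem (hb : ∀ i, D.IsPrim (b i)) {φ : H →ₗ[ℂ] ℂ} (hφ : φ 1 = 0)
    {n m : ℕ} {y x : H} (hy : y ∈ wordSpan b (n + 1)) (hx : x ∈ wordSpan b (m + 1)) :
    ((m.factorial : ℂ) * n.factorial) • (D.slice φ ^ (m + n)) (y * x)
      = ((m + n).factorial : ℂ) • ((D.slice φ ^ n) y * (D.slice φ ^ m) x) := by
  let L : H →ₗ[ℂ] H := ((m.factorial : ℂ) * n.factorial) •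
    (D.slice φ ^ (m + n)) ∘ₗ LinearMap.mulRight ℂ x
  let R : H →ₗ[ℂ] H := ((m + n).factorial : ℂ) •
    LinearMap.mulRight ℂ ((D.slice φ ^ m) x) ∘ₗ (D.slice φ ^ n)
  have : wordSpan b (n + 1) ≤ LinearMap.eqLocus L R := wordSpan_le fun l hl => by
    simp only [L, R, LinearMap.mem_eqLocus, LinearMap.smul_apply, LinearMap.comp_apply,
      LinearMap.mulRight_apply]
    rcases (Nat.lt_succ_iff.1 hl).eq_or_lt with rfl | hl
    · rw [slice_pow_word hb hφ, mul_comm, ← smul_smul, slice_pow_word_mul hb hφ l hx, smul_smul,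
        smul_mul_assoc, one_mul, smul_smul]
      congr 1
      ring
    · rw [slice_pow_eq_zero hb hφ (word_mem_wordSpan hl), slice_pow_eq_zero hb hφ]
      · simp
      · exact wordSpan_mono (by omega) (word_mul_mem_wordSpan l hx)
  exact this hy

theorem exists_mvPolynomial (hb : ∀ i, D.IsPrim (b i))
    (hbr : ∀ i j, b i * b j - b j * b i ∈ Submodule.span ℂ (Set.range b))
    (σ : MvPolynomial I ℂ →ₗ[ℂ] H)
    (hσ : ∀ s, σ (MvPolynomial.monomial s 1) = (s.toMultiset.toList.map b).prod)
    {n : ℕ} {x : H} (hx : x ∈ wordSpan b (n + 1)) :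
    ∃ p : MvPolynomial I ℂ, x - σ p ∈ wordSpan b n ∧ ∀ φ : H →ₗ[ℂ] ℂ, φ 1 = 0 →
      (D.slice φ ^ n) x = ((n.factorial : ℂ) * MvPolynomial.eval (fun i => φ (b i)) p) • 1 := by
  classical
  induction hx using Submodule.span_induction with
  | mem x hx =>
    obtain ⟨l, hl, rfl⟩ := hx
    rcases (Nat.lt_succ_iff.1 hl).eq_or_lt with rfl | hl
    · refine ⟨MvPolynomial.monomial (Multiset.toFinsupp (l : Multiset I)) 1, ?_, fun φ hφ => ?_⟩
      · rw [hσ]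
        refine word_sub_word_mem_wordSpan hbr ?_
        rw [← Multiset.coe_eq_coe]
        simp
      · rw [slice_pow_word hb hφ]
        congr 2
        rw [MvPolynomial.eval_monomial, one_mul, Finsupp.prod, Multiset.toFinsupp_support,
          ← Multiset.prod_coe, ← Multiset.map_coe, Finset.prod_multiset_map_count]
        simp
    · exact ⟨0, by simpa using word_mem_wordSpan hl, fun φ hφ => by
        simp [slice_pow_eq_zero hb hφ (word_mem_wordSpan hl)]⟩
  | zero => exact ⟨0, by simp, by simp⟩
  | add x y _ _ hx hy =>
    obtain ⟨p, hp, hp'⟩ := hx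
    obtain ⟨q, hq, hq'⟩ := hy
    refine ⟨p + q, by simpa [add_sub_add_comm] using add_mem hp hq, fun φ hφ => ?_⟩
    rw [map_add, map_add, hp' φ hφ, hq' φ hφ, ← add_smul, mul_add]
  | smul c x _ hx =>
    obtain ⟨p, hp, hp'⟩ := hx
    refine ⟨c • p, by simpa [smul_sub] using Submodule.smul_mem _ c hp, fun φ hφ => ?_⟩
    rw [map_smul, hp' φ hφ, smul_smul, MvPolynomial.smul_eval, mul_left_comm]

theorem mem_wordSpan_of_slice_pow_eq_zero (hb : ∀ i, D.IsPrim (b i))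
    (hε : ∀ i, D.counit (b i) = 0) (hli : LinearIndependent ℂ b)
    (hbr : ∀ i j, b i * b j - b j * b i ∈ Submodule.span ℂ (Set.range b))
    {n : ℕ} {x : H} (hx : x ∈ wordSpan b (n + 1))
    (h : ∀ φ : H →ₗ[ℂ] ℂ, φ 1 = 0 → (D.slice φ ^ n) x = 0) : x ∈ wordSpan b n := by
  have : Nontrivial H := ⟨1, 0, fun h => by simpa [D.counit_one] using congr(D.counit $h)⟩
  obtain ⟨p, hp, hp'⟩ := exists_mvPolynomial hb hbr
    ((MvPolynomial.basisMonomials I ℂ).constr ℂ fun s => (s.toMultiset.toList.map b).prod)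
    (fun s => Module.Basis.constr_basis (MvPolynomial.basisMonomials I ℂ) ℂ _ s) hx
  suffices p = 0 by simpa [this] using hp
  refine MvPolynomial.funext fun f => ?_
  obtain ⟨g, hg⟩ := LinearMap.exists_extend ((Module.Basis.span hli).constr ℂ f)
  have hgb : ∀ i, g (b i) = f i := fun i => by
    have := congr($hg (Module.Basis.span hli i))
    rwa [Module.Basis.constr_basis, LinearMap.comp_apply, Submodule.subtype_apply,
      Module.Basis.span_apply] at this
  have h1 : (g - g 1 • D.counit) 1 = 0 := by simp [D.counit_one]
  have := hp' _ h1
  rw [h _ h1] at this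
  simpa [hε, hgb, Nat.factorial_ne_zero] using this.symm

/-- The augmentation ideal of an enveloping algebra has neither idempotents nor elements of
square zero. -/
theorem eq_zero_of_mul_self_eq_smul (hb : ∀ i, D.IsPrim (b i))
    (hε : ∀ i, D.counit (b i) = 0) (hli : LinearIndependent ℂ b)
    (hbr : ∀ i j, b i * b j - b j * b i ∈ Submodule.span ℂ (Set.range b))
    (hgen : Algebra.adjoin ℂ (Set.range b) = ⊤) {y : H} {c : ℂ}
    (hy : y * y = c • y) (hy0 : D.counit y = 0) : y = 0 := by
  obtain ⟨n, hn⟩ := exists_mem_wordSpan hgen y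
  have key : ∀ n, y ∈ wordSpan b (n + 1) → y ∈ wordSpan b 1 := by
    intro n
    induction n with
    | zero => exact id
    | succ n ih =>
      intro hn
      refine ih (mem_wordSpan_of_slice_pow_eq_zero hb hε hli hbr hn fun φ hφ => ?_)
      have h := slice_pow_mul_of_mem hb hφ hn hn
      rw [hy, map_smul, slice_pow_eq_zero hb hφ (wordSpan_mono (by omega) hn), smul_zero,
        smul_zero, eq_comm, smul_eq_zero] at h
      obtain ⟨d, hd⟩ := exists_smul_one_of_mem_wordSpan_one
        (slice_pow_mem hb hφ (m := 1) (by rwa [add_comm]))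
      rw [hd] at h ⊢
      have h := congr(D.counit $(h.resolve_left (by exact_mod_cast Nat.factorial_ne_zero _)))
      have : d = 0 := by simpa [D.counit_one] using h
      simp [this]
  obtain ⟨d, rfl⟩ := exists_smul_one_of_mem_wordSpan_one
    (key n (wordSpan_mono n.le_succ hn))
  have : d = 0 := by simpa [D.counit_one] using hy0
  simp [this]

end slice

end HopfStarData
section enveloping

variable {D : HopfStarData H}

theorem eq_zero_of_mul_self_eq_smul_of_enveloping {L : Type*} [LieRing L] {ι : L → H}
    (hbr : ∀ ξ η, ι ⁅ξ, η⁆ = ι ξ * ι η - ι η * ι ξ)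
    (hprim : ∀ ξ, D.IsPrim (ι ξ)) (hcount : ∀ ξ, D.counit (ι ξ) = 0)
    (hgen : Algebra.adjoin ℂ (Set.range ι) = ⊤) {y : H} {c : ℂ}
    (hy : y * y = c • y) (hy0 : D.counit y = 0) : y = 0 := by
  set W := Submodule.span ℂ (Set.range ι) with hW
  let β := Module.Basis.ofVectorSpace ℂ W
  let b : Module.Basis.ofVectorSpaceIndex ℂ W → H := fun i => β i
  have hspan : Submodule.span ℂ (Set.range b) = W := by
    have h := congr(Submodule.map W.subtype $(β.span_eq))
    rw [Submodule.map_span, ← Set.range_comp, Submodule.map_subtype_top] at h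
    exact h
  have hprim' : W ≤ LinearMap.eqLocus D.comul
      ((TensorProduct.mk ℂ H H).flip 1 + TensorProduct.mk ℂ H H 1) :=
    Submodule.span_le.2 (by rintro _ ⟨ξ, rfl⟩; exact hprim ξ)
  have hcount' : W ≤ LinearMap.ker D.counit :=
    Submodule.span_le.2 (by rintro _ ⟨ξ, rfl⟩; exact hcount ξ)
  have hbr' : ∀ v ∈ W, ∀ w ∈ W, v * w - w * v ∈ W := by
    intro v hv w hw
    induction hv, hw using Submodule.span_induction₂ with
    | mem_mem v w hv hw =>
      obtain ⟨ξ, rfl⟩ := hv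
      obtain ⟨η, rfl⟩ := hw
      exact hbr ξ η ▸ Submodule.subset_span ⟨_, rfl⟩
    | zero_left => simp
    | zero_right => simp
    | add_left x y z _ _ _ hx hy =>
      convert add_mem hx hy using 1
      noncomm_ring
    | add_right x y z _ _ _ hx hy =>
      convert add_mem hx hy using 1
      noncomm_ring
    | smul_left r x y _ _ h => simpa [smul_sub] using W.smul_mem r h
    | smul_right r x y _ _ h => simpa [smul_sub] using W.smul_mem r h
  refine HopfStarData.eq_zero_of_mul_self_eq_smul (b := b) (fun i => hprim' (β i).2)
    (fun i => hcount' (β i).2)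
    (β.linearIndependent.map' W.subtype W.ker_subtype)
    (fun i j => hspan.symm ▸ hbr' _ (β i).2 _ (β j).2) ?_ hy hy0
  rw [← Algebra.adjoin_span, hspan, hW, Algebra.adjoin_span, hgen]

theorem star_smul_of_enveloping {ι : 𝔤 → H}
    (hsmul : ∀ (r : ℝ) ξ, ι (r • ξ) = (r : ℂ) • ι ξ)
    (hbr : ∀ ξ η, ι ⁅ξ, η⁆ = ι ξ * ι η - ι η * ι ξ)
    (hprim : ∀ ξ, D.IsPrim (ι ξ)) (hstarι : ∀ ξ, star (ι ξ) = - ι ξ)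
    (hcount : ∀ ξ, D.counit (ι ξ) = 0)
    (hgen : Algebra.adjoin ℂ (Set.range ι) = ⊤) (c : ℂ) (h : H) :
    star (c • h) = starRingEnd ℂ c • star h := by
  have hmul : ∀ (c : ℂ) (h : H), star (c • h) = star (c • (1 : H)) * star h := fun c h => by
    rw [← star_mul, mul_smul_comm, mul_one]
  suffices hone : ∀ c : ℂ, star (c • (1 : H)) = starRingEnd ℂ c • 1 by
    rw [hmul, hone, smul_mul_assoc, one_mul]
  have hε : ∀ c : ℂ, D.counit (star (c • (1 : H)) - starRingEnd ℂ c • 1) = 0 := fun c => by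
    simp [D.counit_star, D.counit_one]
  have hreal : ∀ r : ℝ, star ((r : ℂ) • (1 : H)) = (r : ℂ) • 1 := by
    intro r
    set x := star ((r : ℂ) • (1 : H)) - (r : ℂ) • 1 with hx
    have hx0 : D.counit x = 0 := by simpa [hx] using hε r
    have hxι : ∀ ξ, x * ι ξ = 0 := fun ξ => by
      have h1 := hmul (r : ℂ) (ι ξ)
      rw [← hsmul, hstarι, hstarι, hsmul, mul_neg, neg_inj] at h1
      rw [hx, sub_mul, ← h1, smul_mul_assoc, one_mul, sub_self]
    have hxh : ∀ h, x * h = D.counit h • x := fun h =>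
      mem_of_adjoin_range_eq_top hgen
        (LinearMap.eqLocus (LinearMap.mulLeft ℂ x) (D.counit.smulRight x))
        (by simp [D.counit_one])
        (fun ξ h _ => by simp [← mul_assoc, hxι, D.counit_mul, hcount]) h
    refine sub_eq_zero.1 (eq_zero_of_mul_self_eq_smul_of_enveloping (c := 0) hbr hprim hcount hgen
      ?_ hx0)
    rw [hxh, hx0]
  have hI : star (Complex.I • (1 : H)) = -Complex.I • 1 := by
    refine sub_eq_zero.1 (eq_zero_of_mul_self_eq_smul_of_enveloping (c := 2 * Complex.I) hbr hprim
      hcount hgen ?_ (by simpa using hε Complex.I))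
    have h1 : star (Complex.I • (1 : H)) * star (Complex.I • (1 : H)) = -1 := by
      rw [← hmul, smul_smul, Complex.I_mul_I]
      simp
    simp only [sub_mul, mul_sub, h1, smul_mul_assoc, mul_smul_comm, one_mul, mul_one, smul_sub,
      smul_smul]
    rw [neg_mul_neg, Complex.I_mul_I]
    have : (2 * Complex.I * -Complex.I) = 2 := by
      rw [mul_neg, mul_assoc, Complex.I_mul_I]; norm_num
    rw [this]
    module
  intro c
  conv_lhs => rw [← Complex.re_add_im c, add_smul, star_add, hreal, mul_smul, hmul, hreal, hI]
  conv_rhs => rw [← Complex.re_add_im c]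
  simp only [map_add, map_mul, Complex.conj_ofReal, Complex.conj_I]
  rw [add_smul, smul_mul_assoc, one_mul, smul_smul]

end enveloping

theorem eq_of_cocycle_recursion {B X : Type*} [Ring B] [Algebra ℂ B] [Ring A] [Algebra ℂ A]
    {act : B →ₗ[ℂ] A →ₗ[ℂ] A} {ι : X → B} (hgen : Algebra.adjoin ℂ (Set.range ι) = ⊤)
    {F G : B →ₗ[ℂ] A} (p : X → A) (h1 : F 1 = G 1)
    (hF : ∀ ξ h, F (ι ξ * h) = act (ι ξ) (F h) + p ξ * F h)
    (hG : ∀ ξ h, G (ι ξ * h) = act (ι ξ) (G h) + p ξ * G h) : F = G :=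
  LinearMap.ext fun h => mem_of_adjoin_range_eq_top hgen (LinearMap.eqLocus F G) h1
    (fun ξ h (hh : F h = G h) => show F _ = G _ by rw [hF, hG, hh]) h

theorem IsCentral.star_mem [Ring A] [StarRing A] {c : A} (hc : IsCentral c) : IsCentral (star c) := fun x => by
  have := congr(star $(hc (star x)))
  simpa using this.symm

theorem IsCentral.mul_mem [Ring A] {c d : A} (hc : IsCentral c) (hd : IsCentral d) :
    IsCentral (c * d) := fun x => by
  rw [mul_assoc, hd, ← mul_assoc, hc, mul_assoc]

theorem IsCentral.neg_mem [Ring A] {c : A} (hc : IsCentral c) : IsCentral (-c) := fun x => by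
  rw [neg_mul, hc, mul_neg]

theorem IsUnitaryCentral.mul_mem [Ring A] [StarRing A] {c d : A}
    (hc : IsUnitaryCentral c) (hd : IsUnitaryCentral d) :
    IsUnitaryCentral (c * d) := by
  refine ⟨hc.1.mul_mem hd.1, ?_, ?_⟩
  · rw [star_mul, mul_assoc, ← mul_assoc (star c), hc.2.1, one_mul, hd.2.1]
  · rw [star_mul, mul_assoc, ← mul_assoc d, hd.2.2, one_mul, hc.2.2]

/-- The exponential of an anti-Hermitian central element is unitary. -/
theorem isUnitaryCentral_exp [Ring A] [StarRing A] {e : A → A} (hmem : ∀ a, IsCentral a → IsCentral (e a))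
    (headd : ∀ a b, IsCentral a → IsCentral b → e (a + b) = e a * e b) (hzero : e 0 = 1)
    (hestar : ∀ a, IsCentral a → e (star a) = star (e a)) {u : A} (hu : IsCentral u)
    (hus : star u = -u) : IsUnitaryCentral (e u) := by
  refine ⟨hmem u hu, ?_, ?_⟩
  · rw [← hestar u hu, hus, ← headd _ _ hu.neg_mem hu, neg_add_cancel, hzero]
  · rw [← hestar u hu, hus, ← headd _ _ hu hu.neg_mem, add_neg_cancel, hzero]

theorem chat_apply {B : Type} [Ring B] [Algebra ℂ B] [Ring A] [Algebra ℂ A] [StarRing A]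
    (act : B →ₗ[ℂ] A →ₗ[ℂ] A) (c : A) (h : B) : chat act c h = c * act h (star c) := rfl

section action

variable [Ring A] [Algebra ℂ A] {D : HopfStarData H} {act : H →ₗ[ℂ] A →ₗ[ℂ] A}

theorem conv_apply (a b : H →ₗ[ℂ] A) (g : H) :
    conv D a b g = ((D.rep g).map fun p => a p.1 * b p.2).sum := by
  simp [conv, D.rep_spec g, map_list_sum, List.map_map, Function.comp_def]

theorem conv_one (a b : H →ₗ[ℂ] A) : conv D a b 1 = a 1 * b 1 := by
  simp [conv, D.comul_one, Algebra.TensorProduct.one_def]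

theorem conv_prim {v : H} (hv : D.IsPrim v) (a b : H →ₗ[ℂ] A) :
    conv D a b v = a v * b 1 + a 1 * b v := by
  have hv' : D.comul v = v ⊗ₜ[ℂ] 1 + 1 ⊗ₜ[ℂ] v := hv
  simp [conv, hv']

variable [StarRing A]

theorem IsStarAction.act_mul (hact : IsStarAction D act) {v : H} (hv : D.IsPrim v) (x y : A) :
    act v (x * y) = act v x * y + x * act v y := by
  refine (hact.2.2.1 v x y).trans ((conv_apply (act.flip x) (act.flip y) v).symm.trans ?_)
  simp [conv_prim hv, hact.2.1]

/-- If `a` and `b` satisfy the cocycle recursion in a primitive direction `v` with values `p` and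
`q` at `v`, then their convolution product satisfies it with value `p + q`. -/
theorem IsStarAction.conv_prim_mul (hact : IsStarAction D act) {v : H} (hv : D.IsPrim v)
    {a b : H →ₗ[ℂ] A} {p q : A} (hq : IsCentral q)
    (ha : ∀ h, a (v * h) = act v (a h) + p * a h)
    (hb : ∀ h, b (v * h) = act v (b h) + q * b h) (h : H) :
    conv D a b (v * h) = act v (conv D a b h) + (p + q) * conv D a b h := by
  have hv' : D.comul v = v ⊗ₜ[ℂ] 1 + 1 ⊗ₜ[ℂ] v := hv
  simp only [conv, LinearMap.comp_apply, D.comul_mul, hv']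
  induction D.comul h with
  | zero => simp
  | add x y hx hy => simp only [mul_add, map_add, hx, hy]; abel
  | tmul x y =>
    simp only [add_mul, Algebra.TensorProduct.tmul_mul_tmul, one_mul, map_add,
      TensorProduct.map_tmul, LinearMap.mul'_apply, ha, hb, hact.act_mul hv]
    rw [mul_add, ← mul_assoc (a x) q, ← hq (a x)]
    noncomm_ring

theorem IsUElem.prim_mul {a : H →ₗ[ℂ] A} (ha : IsUElem D act a) (hact : IsStarAction D act)
    {v : H} (hv : D.IsPrim v) (h : H) : a (v * h) = act v (a h) + a v * a h := by
  refine (ha.2.1 v h).trans ((conv_apply a (act.flip (a h)) v).symm.trans ?_)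
  simp [conv_prim hv, hact.2.1, ha.1, add_comm]

theorem IsUElem.isCentral {a : H →ₗ[ℂ] A} (ha : IsUElem D act a) (hact : IsStarAction D act)
    {v : H} (hv : D.IsPrim v) : IsCentral (a v) := by
  intro x
  have := (conv_apply (act.flip x) a v).trans
    ((ha.2.2.1 v x).trans (conv_apply a (act.flip x) v).symm)
  rw [conv_prim hv, conv_prim hv] at this
  simp only [LinearMap.flip_apply, hact.2.1, ha.1, mul_one, one_mul] at this
  rw [add_comm, add_left_inj] at this
  exact this.symm

theorem IsUnitaryCentral.chat_one {c : A} (hc : IsUnitaryCentral c) (hact : IsStarAction D act) :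
    chat act c 1 = 1 := by
  rw [chat_apply, hact.2.1, hc.2.2]

theorem IsStarAction.act_one_prim (hact : IsStarAction D act) {v : H} (hv : D.IsPrim v) :
    act v 1 = 0 := by
  simpa using hact.act_mul hv 1 1

theorem IsUnitaryCentral.chat_prim_mul {c : A} (hc : IsUnitaryCentral c)
    (hact : IsStarAction D act) {v : H} (hv : D.IsPrim v) (h : H) :
    chat act c (v * h) = act v (chat act c h) + chat act c v * chat act c h := by
  simp only [chat_apply, hact.1, hact.act_mul hv]
  have h1 : act v c * star c + c * act v (star c) = 0 := by
    rw [← hact.act_mul hv, hc.2.2, hact.act_one_prim hv]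
  have h2 : act h (star c) = star c * (c * act h (star c)) := by
    rw [← mul_assoc, hc.2.1, one_mul]
  have h3 : act v c * act h (star c) = - (c * act v (star c) * (c * act h (star c))) := by
    rw [h2, ← mul_assoc, eq_neg_of_add_eq_zero_left h1, ← h2, neg_mul]
  rw [h3]
  abel

theorem IsUnitaryCentral.chat_mul_prim {c d : A} (hc : IsUnitaryCentral c)
    (hd : IsUnitaryCentral d) (hact : IsStarAction D act) {v : H} (hv : D.IsPrim v) :
    chat act (c * d) v = chat act c v + chat act d v := by
  have h1 : c * d * (act v (star d) * star c) = d * act v (star d) := by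
    rw [← hc.1.star_mem, hc.1, mul_assoc, ← mul_assoc c, hc.2.2, one_mul]
  have h2 : c * d * (star d * act v (star c)) = c * act v (star c) := by
    rw [mul_assoc, ← mul_assoc d, hd.2.2, one_mul]
  simp only [chat_apply, star_mul, hact.act_mul hv, mul_add, h1, h2]
  exact add_comm _ _

/-- A unitary central element acts on `U(H, A)` by changing the value in a primitive direction by
that of its logarithmic derivative. -/
theorem IsUElem.eq_conv_chat {X : Type*} {ι : X → H} (hgen : Algebra.adjoin ℂ (Set.range ι) = ⊤)
    (hprim : ∀ ξ, D.IsPrim (ι ξ)) (hact : IsStarAction D act) {a a' : H →ₗ[ℂ] A}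
    (ha : IsUElem D act a) (ha' : IsUElem D act a') {c : A} (hc : IsUnitaryCentral c)
    (h : ∀ ξ, a' (ι ξ) = chat act c (ι ξ) + a (ι ξ)) : a' = conv D (chat act c) a := by
  refine eq_of_cocycle_recursion (act := act) hgen (fun ξ => a' (ι ξ)) ?_
    (fun ξ => ha'.prim_mul hact (hprim ξ)) fun ξ g => ?_
  · rw [conv_one, hc.chat_one hact, ha.1, ha'.1, one_mul]
  · simp only [h]
    exact hact.conv_prim_mul (hprim ξ) (ha.isCentral hact (hprim ξ))
      (hc.chat_prim_mul hact (hprim ξ)) (ha.prim_mul hact (hprim ξ)) g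

/-- The logarithmic derivative of the exponential is the derivative of the exponent. -/
theorem chat_exp_prim (hact : IsStarAction D act) {v : H} (hv : D.IsPrim v) {e : A → A}
    (headd : ∀ a b, IsCentral a → IsCentral b → e (a + b) = e a * e b) (hzero : e 0 = 1)
    (hder : ∀ (Dv : A →ₗ[ℂ] A), (∀ x y, Dv (x * y) = Dv x * y + x * Dv y) →
      ∀ a, IsCentral a → Dv (e a) = e a * Dv a)
    (hestar : ∀ a, IsCentral a → e (star a) = star (e a)) {u : A} (hu : IsCentral u)
    (hus : star u = -u) : chat act (e u) v = -act v u := by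
  rw [chat_apply, ← hestar u hu, hus, hder _ (hact.act_mul hv) _ hu.neg_mem, ← mul_assoc,
    ← headd _ _ hu hu.neg_mem, add_neg_cancel, hzero, one_mul, map_neg]

/-- The unitarity condition propagates along primitive directions. -/
theorem IsStarAction.star_antipode_prim_mul (hact : IsStarAction D act) {v : H}
    (hvs : star v = -v) (hvS : D.antipode v = -v) {a : H →ₗ[ℂ] A} {p : A} (hp : IsCentral p)
    (hps : star p = -p) (ha : ∀ h, a (v * h) = act v (a h) + p * a h) (h : H) :
    star (a (D.antipode (star (v * h))))
      = act v (star (a (D.antipode (star h)))) + -p * star (a (D.antipode (star h))) := by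
  rw [star_mul, hvs, mul_neg, map_neg, D.antipode_mul, hvS, neg_mul, neg_neg, ha, star_add,
    hact.2.2.2.2, hvS, star_neg, hvs, neg_neg, star_mul, hps, hp.neg_mem]

/-- `star` on an algebra acted on by `H` is conjugate linear if it is so on `H`. -/
theorem IsStarAction.star_smul (hact : IsStarAction D act)
    (hH : ∀ (c : ℂ) (h : H), star (c • h) = starRingEnd ℂ c • star h) (c : ℂ) (x : A) :
    star (c • x) = starRingEnd ℂ c • star x := by
  have h := hact.2.2.2.2 (c • 1) x
  rwa [map_smul, LinearMap.smul_apply, hact.2.1, map_smul, D.antipode_one, hH, star_one, map_smul,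
    LinearMap.smul_apply, hact.2.1] at h

/-- A linear map satisfying the cocycle recursion with anti-Hermitian central values on the
generators belongs to `U(H, A)`. -/
theorem IsStarAction.isUElem_of_recursion (hact : IsStarAction D act) {X : Type*} {ι : X → H}
    (hH : ∀ (c : ℂ) (h : H), star (c • h) = starRingEnd ℂ c • star h)
    (hgen : Algebra.adjoin ℂ (Set.range ι) = ⊤) (hprim : ∀ ξ, D.IsPrim (ι ξ))
    (hstarι : ∀ ξ, star (ι ξ) = - ι ξ) (hS : ∀ ξ, D.antipode (ι ξ) = - ι ξ)
    (hcount : ∀ ξ, D.counit (ι ξ) = 0) {α : X → A}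
    (hα : ∀ ξ, IsCentral (α ξ) ∧ star (α ξ) = - α ξ) {a : H →ₗ[ℂ] A} (h1 : a 1 = 1)
    (ha : ∀ ξ h, a (ι ξ * h) = act (ι ξ) (a h) + α ξ * a h) : IsUElem D act a := by
  have hflip : ∀ x ξ h, act.flip x (ι ξ * h) = act (ι ξ) (act.flip x h) + 0 * act.flip x h :=
    fun x ξ h => by simp [hact.1]
  have h0 : IsCentral (0 : A) := fun x => by simp
  have hleft : ∀ x ξ h, conv D a (act.flip x) (ι ξ * h)
      = act (ι ξ) (conv D a (act.flip x) h) + α ξ * conv D a (act.flip x) h := fun x ξ h => by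
    simpa using hact.conv_prim_mul (hprim ξ) h0 (ha ξ) (hflip x ξ) h
  refine ⟨h1, fun g h => ?_, fun g x => ?_, fun g => ?_⟩
  · have key : ∀ g h, a (g * h) = conv D a (act.flip (a h)) g := fun g h =>
      congr($(eq_of_cocycle_recursion (act := act) (F := a ∘ₗ LinearMap.mulRight ℂ h) hgen α
        (by simp [conv_one, h1, hact.2.1]) (fun ξ g => by simp [mul_assoc, ha])
        (hleft (a h))) g)
    exact (key g h).trans (conv_apply _ _ _)
  · have key : conv D (act.flip x) a = conv D a (act.flip x) :=
      eq_of_cocycle_recursion (act := act) hgen α (by simp [conv_one, h1])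
        (fun ξ h => by
          simpa using hact.conv_prim_mul (hprim ξ) (hα ξ).1 (hflip x ξ) (ha ξ) h) (hleft x)
    exact (conv_apply (act.flip x) a g).symm.trans
      (congr($key g).trans (conv_apply a (act.flip x) g))
  · let b : H →ₗ[ℂ] A :=
      { toFun := fun h => star (a (D.antipode (star h)))
        map_add' := fun x y => by simp
        map_smul' := fun c x => by simp [hH, hact.star_smul hH] }
    have hb : ∀ ξ h, b (ι ξ * h) = act (ι ξ) (b h) + -α ξ * b h := fun ξ h =>
      hact.star_antipode_prim_mul (hstarι ξ) (hS ξ) (hα ξ).1 (hα ξ).2 (ha ξ) h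
    have key : conv D a b = convUnit D :=
      eq_of_cocycle_recursion (act := act) hgen (fun _ => 0)
        (by simp [conv_one, h1, b, D.antipode_one, convUnit, D.counit_one])
        (fun ξ h => by
          simpa using hact.conv_prim_mul (hprim ξ) (hα ξ).1.neg_mem (ha ξ) (hb ξ) h)
        (fun ξ h => by
          simp [convUnit, D.counit_mul, hcount, Algebra.algebraMap_eq_smul_one,
            hact.act_one_prim (hprim ξ)])
    rw [← Algebra.algebraMap_eq_smul_one]
    exact (conv_apply a b g).symm.trans congr($key g)

end action

/-- assume `A` has an exponential function `e` on its center.  Then the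
restriction `a ↦ a|_𝔤` induces a canonical isomorphism between
`U₀(U_ℂ(𝔤), A) = U(U_ℂ(𝔤), A) / \widehat{U(Z(A))}` and the quotient of
`H¹_CE(𝔤, Z(A)_{anti-Herm})` by the image of `H¹_dR(Z(A), 2πiℤ) = U(Z(A))/exp` under
`c ↦ [ξ ↦ c (ξ ▷ c⁻¹)]`: elementwise, two elements `a, a'` of `U(U_ℂ(𝔤), A)` are
equivalent modulo `\widehat{U(Z(A))}` if and only if their restrictions differ by a
Chevalley–Eilenberg coboundary plus a cocycle `ĉ` with `c` unitary central, and every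
cocycle class is hit. -/
theorem U0_isomorphic_to_quotient_of_H1
    [Ring A] [Algebra ℂ A] [StarRing A]
    (D : HopfStarData H) (act : H →ₗ[ℂ] A →ₗ[ℂ] A) (hact : IsStarAction D act)
    (ι : 𝔤 → H)
    (hadd : ∀ ξ η, ι (ξ + η) = ι ξ + ι η)
    (hsmul : ∀ (r : ℝ) ξ, ι (r • ξ) = (r : ℂ) • ι ξ)
    (hbr : ∀ ξ η, ι ⁅ξ, η⁆ = ι ξ * ι η - ι η * ι ξ)
    (hprim : ∀ ξ, D.comul (ι ξ) = ι ξ ⊗ₜ[ℂ] 1 + 1 ⊗ₜ[ℂ] ι ξ)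
    (hstarι : ∀ ξ, star (ι ξ) = - ι ξ)
    (hS : ∀ ξ, D.antipode (ι ξ) = - ι ξ)
    (hcount : ∀ ξ, D.counit (ι ξ) = 0)
    (hgen : Algebra.adjoin ℂ (Set.range ι) = ⊤)
    (huniv : ∀ (B : Type) [Ring B] [Algebra ℂ B] (f : 𝔤 → B),
      (∀ ξ η, f (ξ + η) = f ξ + f η) →
      (∀ (r : ℝ) ξ, f (r • ξ) = (r : ℂ) • f ξ) →
      (∀ ξ η, f ⁅ξ, η⁆ = f ξ * f η - f η * f ξ) →
      ∃! φ : H →ₐ[ℂ] B, ∀ ξ, φ (ι ξ) = f ξ)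
    -- an exponential function on the center of `A`
    (e : A → A)
    (hmem : ∀ a, IsCentral a → IsCentral (e a))
    (headd : ∀ a b, IsCentral a → IsCentral b → e (a + b) = e a * e b)
    (hzero : e 0 = 1)
    (hder : ∀ (Dv : A →ₗ[ℂ] A), (∀ x y, Dv (x * y) = Dv x * y + x * Dv y) →
      ∀ a, IsCentral a → Dv (e a) = e a * Dv a)
    (hestar : ∀ a, IsCentral a → e (star a) = star (e a)) :
    -- the induced map on quotients is well defined, injective ...
    (∀ a a', IsUElem D act a → IsUElem D act a' →
      ((∃ c, IsUnitaryCentral c ∧ a' = conv D (chat act c) a) ↔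
       (∃ z c, IsCentral z ∧ star z = -z ∧ IsUnitaryCentral c ∧
         ∀ ξ, a' (ι ξ) = a (ι ξ) + act (ι ξ) z + c * act (ι ξ) (star c)))) ∧
    -- ... and surjective
    (∀ α : 𝔤 → A,
      (∀ ξ η, α (ξ + η) = α ξ + α η) →
      (∀ (r : ℝ) ξ, α (r • ξ) = (r : ℂ) • α ξ) →
      (∀ ξ, IsCentral (α ξ) ∧ star (α ξ) = - α ξ) →
      (∀ ξ η, α ⁅ξ, η⁆ = act (ι ξ) (α η) - act (ι η) (α ξ)) →
      ∃ a, IsUElem D act a ∧ ∀ ξ, a (ι ξ) = α ξ) := by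
  have hprim' : ∀ ξ, D.IsPrim (ι ξ) := hprim
  refine ⟨fun a a' ha ha' => ⟨?_, ?_⟩, fun α hαadd hαsmul hα hαbr => ?_⟩
  · rintro ⟨c, hc, rfl⟩
    refine ⟨0, c, fun x => by simp, by simp, hc, fun ξ => ?_⟩
    rw [conv_prim (hprim' ξ), hc.chat_one hact, ha.1, chat_apply]
    simp [add_comm]
  · rintro ⟨z, c, hz, hzs, hc, h⟩
    have hzs' : star (-z) = - -z := by rw [star_neg, hzs]
    have hez := isUnitaryCentral_exp hmem headd hzero hestar hz.neg_mem hzs'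
    refine ⟨e (-z) * c, hez.mul_mem hc,
      ha.eq_conv_chat hgen hprim' hact ha' (hez.mul_mem hc) fun ξ => ?_⟩
    rw [hez.chat_mul_prim hc hact (hprim' ξ),
      chat_exp_prim hact (hprim' ξ) headd hzero hder hestar hz.neg_mem hzs', chat_apply, h,
      map_neg, neg_neg]
    abel
  · obtain ⟨φ, hφ, -⟩ := huniv (Module.End ℂ A) (fun ξ => act (ι ξ) + LinearMap.mulLeft ℂ (α ξ))
      (fun ξ η => by ext x; simp [hadd, hαadd, add_mul]; abel)
      (fun r ξ => by ext x; simp [hsmul, hαsmul])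
      (fun ξ η => by
        ext x
        simp only [LinearMap.add_apply, LinearMap.sub_apply, Module.End.mul_apply,
          LinearMap.mulLeft_apply, hbr, hαbr, map_sub, hact.1,
          hact.act_mul (hprim' _), ← mul_assoc, sub_mul, mul_add, (hα ξ).1 (α η)]
        abel)
    let a : H →ₗ[ℂ] A := LinearMap.applyₗ 1 ∘ₗ φ.toLinearMap
    have ha1 : a 1 = 1 := by simp [a]
    have ha : ∀ ξ h, a (ι ξ * h) = act (ι ξ) (a h) + α ξ * a h := fun ξ h => by simp [a, hφ]
    have hH := star_smul_of_enveloping hsmul hbr hprim' hstarι hcount hgen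
    refine ⟨a, hact.isUElem_of_recursion hH hgen hprim' hstarι hS hcount hα ha1 ha, fun ξ => ?_⟩
    simpa [ha1, hact.act_one_prim (hprim' ξ)] using ha ξ 1
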